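/- arXiv:2404.01505 — 2 statements merged into one kernel-verified Lean document; each statement's English description precedes it below -/
import Mathlib

section
/- Let u : ℝ³ → ℝ³ be continuously differentiable with curl ω = ∇×u, where ω is continuous, integrable and bounded, and suppose u has the Biot-Savart representation u(x) = −(1/(4π)) ∫_{ℝ³} ((x−y)/|x−y|³) × ω(y) dy for every x ∈ ℝ³. Then u is permutation symmetric if and only if ω = ω^{P_f} = ω^{P_b} = −ω^{P₁₂} = −ω^{P₁₃} = −ω^{P₂₃}. -/
open Matrix MeasureTheory Real

noncomputable section

abbrev V3 := Fin 3 → ℝ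

/-- The Euclidean norm on `ℝ³`. -/
def enorm3 (x : V3) : ℝ := Real.sqrt (∑ i, x i ^ 2)

/-- The transformed vector field `u^Q(x) = Q u(Qᵀ x)`. -/
def transform (Q : Matrix (Fin 3) (Fin 3) ℝ) (u : V3 → V3) : V3 → V3 :=
  fun x => Q.mulVec (u (Qᵀ.mulVec x))

/-- The partial derivative `∂_i f` at `x`. -/
def pd (i : Fin 3) (f : V3 → ℝ) (x : V3) : ℝ := fderiv ℝ f x (Pi.single i 1)

/-- The curl `∇×u = (∂₂u₃ − ∂₃u₂, ∂₃u₁ − ∂₁u₃, ∂₁u₂ − ∂₂u₁)`. -/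
def curl (u : V3 → V3) (x : V3) : V3 :=
  ![pd 1 (fun y => u y 2) x - pd 2 (fun y => u y 1) x,
    pd 2 (fun y => u y 0) x - pd 0 (fun y => u y 2) x,
    pd 0 (fun y => u y 1) x - pd 1 (fun y => u y 0) x]

def P12 : Matrix (Fin 3) (Fin 3) ℝ := !![0,1,0;1,0,0;0,0,1]
def P13 : Matrix (Fin 3) (Fin 3) ℝ := !![0,0,1;0,1,0;1,0,0]
def P23 : Matrix (Fin 3) (Fin 3) ℝ := !![1,0,0;0,0,1;0,1,0]
def Pf : Matrix (Fin 3) (Fin 3) ℝ := !![0,0,1;1,0,0;0,1,0]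
def Pb : Matrix (Fin 3) (Fin 3) ℝ := !![0,1,0;0,0,1;1,0,0]

/-- The group `𝒫₃` of six 3×3 permutation matrices. -/
def perms : Set (Matrix (Fin 3) (Fin 3) ℝ) := {1, P12, P13, P23, Pf, Pb}

/-- `u` is permutation symmetric if `u^P = u` for every `P ∈ 𝒫₃`. -/
def PermSymmetric (u : V3 → V3) : Prop := ∀ P ∈ perms, transform P u = u

/-- The Biot-Savart kernel `((x−y)/|x−y|³) × ω(y)`. -/
def bsKernel (ω : V3 → V3) (x y : V3) : V3 :=
  crossProduct ((enorm3 (x - y) ^ 3)⁻¹ • (x - y)) (ω y)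

/-- `u` has the Biot-Savart representation from `ω`. -/
def BiotSavartRep (u ω : V3 → V3) : Prop :=
  ∀ x, Integrable (bsKernel ω x) ∧ u x = (-(4 * π)⁻¹) • ∫ y : V3, bsKernel ω x y

theorem adjugate_of_orthogonal {Q : Matrix (Fin 3) (Fin 3) ℝ} (hQ : Qᵀ * Q = 1) :
    Q.adjugate = Q.det • Qᵀ := by
  have hinv : Q * Qᵀ = 1 := mul_eq_one_comm.mp hQ
  calc Q.adjugate = Q.adjugate * (Q * Qᵀ) := by rw [hinv, mul_one]
    _ = Q.det • Qᵀ := by rw [← Matrix.mul_assoc, adjugate_mul, smul_mul, Matrix.one_mul]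

theorem det_sq_of_orthogonal {Q : Matrix (Fin 3) (Fin 3) ℝ} (hQ : Qᵀ * Q = 1) :
    Q.det * Q.det = 1 := by
  simpa using congrArg det hQ

theorem cofactors_of_orthogonal {Q : Matrix (Fin 3) (Fin 3) ℝ} (hQ : Qᵀ * Q = 1) (i j : Fin 3) :
    Q.det * Q i j = Q.adjugate j i := by
  rw [adjugate_of_orthogonal hQ]
  simp

theorem cross_mulVec_of_orthogonal {Q : Matrix (Fin 3) (Fin 3) ℝ} (hQ : Qᵀ * Q = 1) (a b : V3) :
    crossProduct (Q *ᵥ a) (Q *ᵥ b) = Q.det • Q *ᵥ crossProduct a b := by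
  have hc := cofactors_of_orthogonal hQ
  rw [← smul_mulVec]
  ext i
  fin_cases i <;>
  · simp [mulVec, dotProduct, Fin.sum_univ_three, cross_apply, hc, adjugate_fin_three]
    ring

theorem pd_transform (Q : Matrix (Fin 3) (Fin 3) ℝ) {u : V3 → V3} (hu : Differentiable ℝ u)
    (i k : Fin 3) (x : V3) :
    pd i (fun y => transform Q u y k) x =
      ∑ l, ∑ m, Q k l * Q i m * pd m (fun y => u y l) (Qᵀ *ᵥ x) := by
  set L : V3 →L[ℝ] V3 := Qᵀ.mulVecLin.toContinuousLinearMap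
  have hd (l : Fin 3) : DifferentiableAt ℝ (fun y => u y l) (Qᵀ *ᵥ x) :=
    differentiableAt_pi.mp (hu _) l
  have hcomp (l : Fin 3) : HasFDerivAt (fun y => u (Qᵀ *ᵥ y) l)
      ((fderiv ℝ (fun y => u y l) (Qᵀ *ᵥ x)).comp L) x :=
    HasFDerivAt.comp (g := fun y => u y l) (f := fun y => Qᵀ *ᵥ y) x
      (hd l).hasFDerivAt L.hasFDerivAt
  have hsum : HasFDerivAt (fun y => transform Q u y k)
      (∑ l, Q k l • (fderiv ℝ (fun y => u y l) (Qᵀ *ᵥ x)).comp L) x :=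
    HasFDerivAt.fun_sum (u := Finset.univ) fun l _ => (hcomp l).const_mul (Q k l)
  have hL : L (Pi.single i 1) = ∑ m, Q i m • (Pi.single m 1 : V3) := by
    ext j
    simp [L, Pi.single_apply]
  simp only [pd, hsum.fderiv, _root_.sum_apply, _root_.smul_apply,
    ContinuousLinearMap.comp_apply, hL, map_sum, map_smul, smul_eq_mul, Finset.mul_sum, mul_assoc]

theorem curl_transform {Q : Matrix (Fin 3) (Fin 3) ℝ} (hQ : Qᵀ * Q = 1) {u : V3 → V3}
    (hu : Differentiable ℝ u) :
    curl (transform Q u) = Q.det • transform Q (curl u) := by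
  have hc := cofactors_of_orthogonal hQ
  ext x i
  rw [Pi.smul_apply, transform, ← smul_mulVec]
  fin_cases i <;>
  · simp [curl, pd_transform Q hu, mulVec, dotProduct, Fin.sum_univ_three, hc,
      adjugate_fin_three]
    ring

theorem enorm3_mulVec_of_orthogonal {Q : Matrix (Fin 3) (Fin 3) ℝ} (hQ : Qᵀ * Q = 1) (x : V3) :
    enorm3 (Q *ᵥ x) = enorm3 x := by
  have h : Q *ᵥ x ⬝ᵥ Q *ᵥ x = x ⬝ᵥ x := by
    rw [dotProduct_mulVec, vecMul_mulVec, hQ, vecMul_one]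
  simp only [dotProduct, ← sq] at h
  rw [enorm3, enorm3, h]

theorem bsKernel_transform {Q : Matrix (Fin 3) (Fin 3) ℝ} (hQ : Qᵀ * Q = 1) (ω : V3 → V3)
    (x y : V3) :
    bsKernel (Q.det • transform Q ω) x y = Q *ᵥ bsKernel ω (Qᵀ *ᵥ x) (Qᵀ *ᵥ y) := by
  have hinv : Q * Qᵀ = 1 := mul_eq_one_comm.mp hQ
  have hx : x - y = Q *ᵥ (Qᵀ *ᵥ x - Qᵀ *ᵥ y) := by
    rw [← mulVec_sub, mulVec_mulVec, hinv, one_mulVec]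
  rw [bsKernel, bsKernel, hx, enorm3_mulVec_of_orthogonal hQ, Pi.smul_apply, transform,
    map_smul, ← mulVec_smul, cross_mulVec_of_orthogonal hQ, smul_smul,
    det_sq_of_orthogonal hQ, one_smul]

theorem integral_comp_mulVec_of_orthogonal {Q : Matrix (Fin 3) (Fin 3) ℝ} (hQ : Qᵀ * Q = 1)
    (f : V3 → V3) : ∫ y, f (Q *ᵥ y) = ∫ y, f y := by
  have hdet := det_sq_of_orthogonal hQ
  have habs : |Q.det| = 1 := by
    rcases mul_self_eq_one_iff.mp hdet with h | h <;> simp [h]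
  have h0 : Q.toLin'.det ≠ 0 := by
    rw [LinearMap.det_toLin']
    rintro h
    simp [h] at hdet
  have hmap : Measure.map Q.toLin' (volume : Measure V3) = volume := by
    rw [Real.map_linearMap_volume_pi_eq_smul_volume_pi h0, LinearMap.det_toLin', abs_inv, habs]
    simp
  have hmp : MeasurePreserving (Q.toLin' : V3 → V3) :=
    ⟨Q.toLin'.toContinuousLinearMap.continuous.measurable, hmap⟩
  have hleft : Function.LeftInverse (fun x => Qᵀ *ᵥ x) (fun x => Q *ᵥ x) := fun x => by
    simp [hQ]
  have hemb : MeasurableEmbedding (Q.toLin' : V3 → V3) :=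
    (Q.toLin'.toContinuousLinearMap.continuous.measurableEmbedding hleft.injective)
  exact hmp.integral_comp hemb f

theorem transform_eq_of_biotSavartRep {Q : Matrix (Fin 3) (Fin 3) ℝ} (hQ : Qᵀ * Q = 1)
    {u ω : V3 → V3} (hbs : BiotSavartRep u ω) (hω : ω = Q.det • transform Q ω) :
    transform Q u = u := by
  have hQt : Qᵀᵀ * Qᵀ = 1 := by
    rw [transpose_transpose]
    exact mul_eq_one_comm.mp hQ
  ext1 x
  have hint : ∫ y, bsKernel ω x y = Q *ᵥ ∫ y, bsKernel ω (Qᵀ *ᵥ x) y := by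
    calc ∫ y, bsKernel ω x y = ∫ y, Q *ᵥ bsKernel ω (Qᵀ *ᵥ x) (Qᵀ *ᵥ y) := by
          conv_lhs => rw [hω]
          simp_rw [bsKernel_transform hQ]
      _ = ∫ y, Q *ᵥ bsKernel ω (Qᵀ *ᵥ x) y :=
          integral_comp_mulVec_of_orthogonal hQt fun y => Q *ᵥ bsKernel ω (Qᵀ *ᵥ x) y
      _ = Q *ᵥ ∫ y, bsKernel ω (Qᵀ *ᵥ x) y :=
          Q.mulVecLin.toContinuousLinearMap.integral_comp_comm (hbs _).1
  rw [transform, (hbs _).2, (hbs x).2, hint, mulVec_smul]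

theorem transform_eq_iff_vorticity {Q : Matrix (Fin 3) (Fin 3) ℝ} (hQ : Qᵀ * Q = 1)
    {u ω : V3 → V3} (hu : Differentiable ℝ u) (hcurl : curl u = ω) (hbs : BiotSavartRep u ω) :
    transform Q u = u ↔ ω = Q.det • transform Q ω := by
  refine ⟨fun h => ?_, transform_eq_of_biotSavartRep hQ hbs⟩
  rw [← hcurl, ← curl_transform hQ hu, h]

/-- A `C¹` vector field `u` with continuous, integrable, bounded curl `ω` having the
Biot-Savart representation is permutation symmetric if and only if
`ω = ω^{P_f} = ω^{P_b} = −ω^{P₁₂} = −ω^{P₁₃} = −ω^{P₂₃}`. -/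
theorem permSymmetric_iff_vorticity_conditions
    (u ω : V3 → V3) (hu : ContDiff ℝ 1 u)
    (hcurl : ∀ x, curl u x = ω x)
    (hωc : Continuous ω) (hωi : Integrable ω) (hωb : ∃ C, ∀ x, enorm3 (ω x) ≤ C)
    (hbs : BiotSavartRep u ω) :
    PermSymmetric u ↔
      (ω = transform Pf ω ∧ ω = transform Pb ω ∧
       ω = -transform P12 ω ∧ ω = -transform P13 ω ∧ ω = -transform P23 ω) := by
  have key (Q : Matrix (Fin 3) (Fin 3) ℝ) (hQ : Qᵀ * Q = 1) :=
    transform_eq_iff_vorticity hQ (hu.differentiable one_ne_zero) (funext hcurl) hbs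
  have hone : transform 1 u = u := by
    ext1 x
    simp [transform]
  have hf := key Pf (by ext i j; fin_cases i <;> fin_cases j <;>
    simp [Pf, mul_apply, Fin.sum_univ_three])
  have hb := key Pb (by ext i j; fin_cases i <;> fin_cases j <;>
    simp [Pb, mul_apply, Fin.sum_univ_three])
  have h12 := key P12 (by ext i j; fin_cases i <;> fin_cases j <;>
    simp [P12, mul_apply, Fin.sum_univ_three])
  have h13 := key P13 (by ext i j; fin_cases i <;> fin_cases j <;>
    simp [P13, mul_apply, Fin.sum_univ_three])
  have h23 := key P23 (by ext i j; fin_cases i <;> fin_cases j <;>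
    simp [P23, mul_apply, Fin.sum_univ_three])
  have df : Pf.det = 1 := by simp [Pf, det_fin_three]
  have db : Pb.det = 1 := by simp [Pb, det_fin_three]
  have d12 : P12.det = -1 := by simp [P12, det_fin_three]
  have d13 : P13.det = -1 := by simp [P13, det_fin_three]
  have d23 : P23.det = -1 := by simp [P23, det_fin_three]
  rw [df, one_smul] at hf
  rw [db, one_smul] at hb
  rw [d12, neg_one_smul] at h12
  rw [d13, neg_one_smul] at h13
  rw [d23, neg_one_smul] at h23
  rw [← hf, ← hb, ← h12, ← h13, ← h23]
  simp only [PermSymmetric, perms, Set.mem_insert_iff, Set.mem_singleton_iff, forall_eq_or_imp,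
    forall_eq, hone, true_and]
  tauto

end
end

section
/- Let u : ℝ³ → ℝ³ be continuously differentiable, permutation symmetric, and divergence free, with curl ω = ∇×u, where ω is integrable, bounded, and α-Hölder continuous on ℝ³ for some α ∈ (0,1), and suppose u has the Biot-Savart representation u(x) = −(1/(4π)) ∫_{ℝ³} ((x−y)/|x−y|³) × ω(y) dy for every x. Then the gradient of u at the origin satisfies ∂_i u_i(0) = 0 for each i and ∂_i u_j(0) = −λ for all i ≠ j, where the integral defining λ := (3/(8π)) ∫_{ℝ³} ((x₁+x₂+x₃)(x₂−x₃)/|x|⁵) ω₁(x) dx converges absolutely; moreover λ = (3/(8π)) ∫_{ℝ³} ((x₁+x₂+x₃)(x₃−x₁)/|x|⁵) ω₂(x) dx = (3/(8π)) ∫_{ℝ³} ((x₁+x₂+x₃)(x₁−x₂)/|x|⁵) ω₃(x) dx. -/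
open Matrix MeasureTheory Real

noncomputable section

open Filter Topology

section EuclideanNorm

lemma enorm3_eq_norm (x : V3) : enorm3 x = ‖WithLp.toLp 2 x‖ := by
  simp [enorm3, EuclideanSpace.norm_eq]

lemma enorm3_nonneg (x : V3) : 0 ≤ enorm3 x := Real.sqrt_nonneg _

lemma enorm3_sq (x : V3) : enorm3 x ^ 2 = x 0 ^ 2 + x 1 ^ 2 + x 2 ^ 2 := by
  rw [enorm3, Real.sq_sqrt (Finset.sum_nonneg fun i _ => sq_nonneg _), Fin.sum_univ_three]

lemma abs_apply_le_enorm3 (x : V3) (i : Fin 3) : |x i| ≤ enorm3 x :=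
  Real.abs_le_sqrt (Finset.single_le_sum (f := fun i => x i ^ 2)
    (fun _ _ => sq_nonneg _) (Finset.mem_univ i))

lemma norm_le_enorm3 (x : V3) : ‖x‖ ≤ enorm3 x :=
  (pi_norm_le_iff_of_nonneg (enorm3_nonneg x)).2 fun i => abs_apply_le_enorm3 x i

lemma enorm3_zero : enorm3 0 = 0 := by simp [enorm3]

lemma enorm3_pos {x : V3} (hx : x ≠ 0) : 0 < enorm3 x :=
  (norm_pos_iff.2 hx).trans_le (norm_le_enorm3 x)

lemma abs_enorm3_sub_enorm3_le (x y : V3) : |enorm3 x - enorm3 y| ≤ enorm3 (x + y) := by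
  have h := abs_norm_sub_norm_le (WithLp.toLp 2 x) (WithLp.toLp 2 (-y))
  rw [← enorm3_eq_norm, ← enorm3_eq_norm, ← WithLp.toLp_sub, ← enorm3_eq_norm] at h
  simpa [enorm3] using h

lemma continuous_enorm3 : Continuous enorm3 := by
  unfold enorm3; fun_prop

lemma enorm3_diagonal_le (t : ℝ) : enorm3 (fun _ => t) ≤ 2 * |t| := by
  refine Real.sqrt_le_iff.2 ⟨by positivity, ?_⟩
  rw [mul_pow, sq_abs, Fin.sum_univ_three]
  nlinarith [sq_nonneg t]

end EuclideanNorm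

section RadialPower

/-- The radial power `‖z‖ ^ p`, truncated to the ball of radius `R`. -/
def truncatedPower (p R : ℝ) (z : V3) : ℝ := (Set.Iio R).indicator (fun r : ℝ => r ^ p) ‖z‖

lemma truncatedPower_nonneg (p R : ℝ) (z : V3) : 0 ≤ truncatedPower p R z :=
  Set.indicator_apply_nonneg fun _ => Real.rpow_nonneg (norm_nonneg _) _

lemma truncatedPower_of_lt {p R : ℝ} {z : V3} (h : ‖z‖ < R) :
    truncatedPower p R z = ‖z‖ ^ p :=
  Set.indicator_of_mem (Set.mem_Iio.2 h) _

lemma sq_mul_indicator_rpow (p R : ℝ) :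
    Set.EqOn (fun y : ℝ => y ^ (Module.finrank ℝ V3 - 1) •
        (Set.Iio R).indicator (fun r : ℝ => r ^ p) y)
      ((Set.Iio R).indicator fun r : ℝ => r ^ (p + 2)) (Set.Ioi 0) := by
  intro y hy
  by_cases h : y ∈ Set.Iio R
  · simp only [Set.indicator_of_mem h, smul_eq_mul, Module.finrank_fin_fun]
    rw [Real.rpow_add hy, mul_comm]
    norm_num
  · simp [Set.indicator_of_notMem h]

lemma integrable_truncatedPower {p : ℝ} (hp : -3 < p) (R : ℝ) :
    Integrable (truncatedPower p R) := by
  refine (integrable_fun_norm_addHaar (volume : Measure V3)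
    (f := (Set.Iio R).indicator fun r : ℝ => r ^ p)).2 ?_
  rw [integrableOn_congr_fun (sq_mul_indicator_rpow p R) measurableSet_Ioi,
    integrableOn_indicator_iff measurableSet_Iio, Set.inter_comm, Set.Ioi_inter_Iio]
  rcases le_or_gt R 0 with hR | hR
  · simp [Set.Ioo_eq_empty (not_lt.2 hR)]
  · exact ((intervalIntegrable_iff_integrableOn_Ioc_of_le hR.le).1
      (intervalIntegral.intervalIntegrable_rpow' (by linarith))).mono_set Set.Ioo_subset_Ioc_self

lemma integral_truncatedPower_neg_two :
    ∃ K : ℝ, ∀ R, 0 ≤ R → ∫ z, truncatedPower (-2) R z = K * R := by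
  refine ⟨3 * (volume : Measure V3).real (Metric.ball 0 1), fun R hR => ?_⟩
  refine (integral_fun_norm_addHaar (volume : Measure V3)
    ((Set.Iio R).indicator fun r : ℝ => r ^ (-2 : ℝ))).trans ?_
  rw [setIntegral_congr_fun measurableSet_Ioi (sq_mul_indicator_rpow (-2) R),
    setIntegral_indicator measurableSet_Iio, Set.Ioi_inter_Iio]
  simp [hR, mul_assoc]

end RadialPower

section Symmetry

/-- Equivariance of `u` under the coordinate permutation `σ`. -/
def EquivariantUnder (σ : Equiv.Perm (Fin 3)) (u : V3 → V3) : Prop :=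
  ∀ x i, u x (σ i) = u (fun k => x (σ k)) i

lemma PermSymmetric.equivariantUnder_finRotate {u : V3 → V3} (hu : PermSymmetric u) :
    EquivariantUnder (finRotate 3) u := by
  have h : transform Pf u = u := hu _ (by simp [perms])
  intro x i
  have hx : (fun k => x (finRotate 3 k)) = Pfᵀ.mulVec x := by
    ext k; fin_cases k <;> simp [Pf, Matrix.mulVec, dotProduct, Fin.sum_univ_three]
  rw [hx]
  nth_rewrite 1 [← h]
  fin_cases i <;> simp [transform, Pf, Matrix.mulVec, dotProduct, Fin.sum_univ_three]

lemma PermSymmetric.equivariantUnder_swap {u : V3 → V3} (hu : PermSymmetric u) :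
    EquivariantUnder (Equiv.swap 0 1) u := by
  have h : transform P12 u = u := hu _ (by simp [perms])
  have h2 : Equiv.swap (0 : Fin 3) 1 2 = 2 := by decide
  intro x i
  have hx : (fun k => x (Equiv.swap 0 1 k)) = P12ᵀ.mulVec x := by
    ext k; fin_cases k <;> simp [P12, Matrix.mulVec, dotProduct, Fin.sum_univ_three, h2]
  rw [hx]
  nth_rewrite 1 [← h]
  fin_cases i <;> simp [transform, P12, Matrix.mulVec, dotProduct, Fin.sum_univ_three, h2]

lemma EquivariantUnder.pd_apply {σ : Equiv.Perm (Fin 3)} {u : V3 → V3}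
    (h : EquivariantUnder σ u) (hu : Differentiable ℝ u) (i j : Fin 3) (x : V3) :
    pd (σ i) (fun y => u y (σ j)) x = pd i (fun y => u y j) (fun k => x (σ k)) := by
  let L : V3 →L[ℝ] V3 := ContinuousLinearMap.pi fun k => ContinuousLinearMap.proj (σ k)
  have hL : ∀ y : V3, L y = fun k => y (σ k) := fun y => rfl
  have hd : Differentiable ℝ fun y => u y j := by fun_prop
  have hcomp : (fun y => u y (σ j)) = (fun y => u y j) ∘ L := by
    ext y; exact h y j
  rw [pd, hcomp, fderiv_comp x (hd _) L.differentiableAt, L.fderiv, pd, ← hL]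
  simp only [ContinuousLinearMap.comp_apply]
  congr 1
  ext k
  simp [hL, Pi.single_apply]

lemma EquivariantUnder.curl_apply {u : V3 → V3} (h : EquivariantUnder (finRotate 3) u)
    (hu : Differentiable ℝ u) : EquivariantUnder (finRotate 3) (curl u) := by
  intro x i
  have key := fun i j => h.pd_apply hu i j x
  fin_cases i <;> simp only [curl, ← key] <;> simp

lemma integral_comp_rotate (F : V3 → ℝ) :
    ∫ x : V3, F (fun k => x (finRotate 3 k)) = ∫ x, F x := by
  have h := volume_measurePreserving_piCongrLeft (fun _ : Fin 3 => ℝ) (finRotate 3)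
  rw [← h.integral_comp' fun x => F fun k => x (finRotate 3 k)]
  refine integral_congr_ae (ae_of_all _ fun x => congrArg F (funext fun k => ?_))
  exact (Equiv.piCongrLeft_apply_apply (fun _ : Fin 3 => ℝ) (finRotate 3) x k)

end Symmetry

section Kernel

/-- The triple product `(1,1,1) · (w × y)`. -/
def axialMoment (y w : V3) : ℝ :=
  w 0 * (y 1 - y 2) + w 1 * (y 2 - y 0) + w 2 * (y 0 - y 1)

lemma abs_axialMoment_le (y w : V3) : |axialMoment y w| ≤ 6 * enorm3 y * ‖w‖ := by
  have hy := fun i j => (abs_sub (y i) (y j)).trans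
    (add_le_add (abs_apply_le_enorm3 y i) (abs_apply_le_enorm3 y j))
  have hterm : ∀ i j k, |w i * (y j - y k)| ≤ 2 * enorm3 y * ‖w‖ := fun i j k => by
    rw [abs_mul, mul_comm]
    refine mul_le_mul ((hy j k).trans_eq (by ring)) (norm_le_pi_norm w i) (abs_nonneg _) ?_
    linarith [enorm3_nonneg y]
  refine (abs_add_three _ _ _).trans ?_
  linarith [hterm 0 1 2, hterm 1 2 0, hterm 2 0 1]

lemma axialMoment_diagonal_sub (t : ℝ) (y w : V3) :
    axialMoment ((fun _ => t) - y) w = -axialMoment y w := by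
  simp only [axialMoment, Pi.sub_apply]; ring

lemma sum_bsKernel_diagonal (ω : V3 → V3) (t : ℝ) (y : V3) :
    ∑ j, bsKernel ω (fun _ => t) y j =
      (enorm3 ((fun _ => t) - y) ^ 3)⁻¹ * axialMoment y (ω y) := by
  simp [bsKernel, cross_apply, Fin.sum_univ_three, axialMoment]; ring

lemma hasDerivAt_inv_enorm3_cube {y : V3} (hy : y ≠ 0) :
    HasDerivAt (fun t : ℝ => (enorm3 ((fun _ => t) - y) ^ 3)⁻¹)
      (3 * (y 0 + y 1 + y 2) / enorm3 y ^ 5) 0 := by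
  have hN := enorm3_pos hy
  have h0 : enorm3 ((fun _ => (0 : ℝ)) - y) = enorm3 y := by simp [enorm3]
  have hq : HasDerivAt (fun t : ℝ => ∑ i, (t - y i) ^ 2) (-2 * (y 0 + y 1 + y 2)) 0 := by
    have := HasDerivAt.fun_sum (u := Finset.univ) fun i _ =>
      (((hasDerivAt_id (0 : ℝ)).sub_const (y i)).pow 2)
    refine this.congr_deriv ?_
    simp [Fin.sum_univ_three]; ring
  have hq0 : (∑ i, ((0 : ℝ) - y i) ^ 2) ≠ 0 := by
    have := enorm3_sq y
    rw [Fin.sum_univ_three]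
    nlinarith [pow_pos hN 2]
  have hs : HasDerivAt (fun t : ℝ => enorm3 ((fun _ => t) - y))
      (-2 * (y 0 + y 1 + y 2) / (2 * enorm3 y)) 0 := by
    rw [← h0]; exact hq.sqrt hq0
  have := (hs.pow 3).inv (by simp only [Pi.pow_apply, h0]; positivity)
  refine this.congr_deriv ?_
  simp only [Pi.pow_apply, h0]
  field_simp
  norm_num
  ring

end Kernel

section Quotient

variable {ω : V3 → V3} {α C : ℝ}

/-- The difference quotient, between `(t,t,t)` and the origin, of the integrand of the sum of the
components of the Biot-Savart integral. -/
def quotientKernel (ω : V3 → V3) (t : ℝ) (y : V3) : ℝ :=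
  t⁻¹ * ((enorm3 ((fun _ => t) - y) ^ 3)⁻¹ - (enorm3 y ^ 3)⁻¹) * axialMoment y (ω y)

lemma inv_cube_mul_self_le (a : ℝ) (ha : 0 ≤ a) : (a ^ 3)⁻¹ * a ≤ (a ^ 2)⁻¹ := by
  rcases ha.eq_or_lt with rfl | ha
  · simp
  · apply le_of_eq; field_simp

lemma inv_enorm3_sq_le_truncatedPower {R : ℝ} {z : V3} (hz : enorm3 z < R) :
    (enorm3 z ^ 2)⁻¹ ≤ truncatedPower (-2) R z := by
  rcases eq_or_ne z 0 with rfl | h0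
  · simpa [enorm3_zero] using truncatedPower_nonneg _ _ _
  · have h := norm_pos_iff.2 h0
    rw [truncatedPower_of_lt ((norm_le_enorm3 z).trans_lt hz), Real.rpow_neg h.le,
      Real.rpow_two]
    gcongr
    exact norm_le_enorm3 z

lemma abs_quotientKernel_le_of_near (hα : 0 < α) (hC : 0 ≤ C)
    (hω : ∀ y, ‖ω y‖ ≤ C * enorm3 y ^ α) {t : ℝ} {y : V3} (hy : enorm3 y < 4 * |t|) :
    |quotientKernel ω t y| ≤ 6 * (|t|⁻¹ * (C * (4 * |t|) ^ α)) *
      (truncatedPower (-2) (6 * |t|) ((fun _ => t) - y) + truncatedPower (-2) (6 * |t|) y) := by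
  set a := enorm3 ((fun _ => t) - y) with ha
  set c := enorm3 y with hc
  set m := axialMoment y (ω y) with hm
  have ha0 : 0 ≤ a := enorm3_nonneg _
  have hc0 : 0 ≤ c := enorm3_nonneg _
  have hac : |a - c| ≤ 2 * |t| := by
    refine (abs_enorm3_sub_enorm3_le _ _).trans ?_
    rw [sub_add_cancel]; exact enorm3_diagonal_le t
  have hma : |m| ≤ a * (6 * ‖ω y‖) := by
    rw [hm, ← abs_neg, ← axialMoment_diagonal_sub t]
    exact (abs_axialMoment_le _ _).trans_eq (by rw [← ha]; ring)
  have hmc : |m| ≤ c * (6 * ‖ω y‖) := (abs_axialMoment_le _ _).trans_eq (by rw [← hc]; ring)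
  have hW : ‖ω y‖ ≤ C * (4 * |t|) ^ α := (hω y).trans (by rw [← hc]; gcongr)
  have hTa : (a ^ 2)⁻¹ ≤ _ :=
    inv_enorm3_sq_le_truncatedPower (R := 6 * |t|) (by linarith [(abs_le.1 hac).2])
  have hTc : (c ^ 2)⁻¹ ≤ _ :=
    inv_enorm3_sq_le_truncatedPower (R := 6 * |t|) (z := y) (by linarith [abs_nonneg t])
  have hone : ∀ b, 0 ≤ b → |m| ≤ b * (6 * ‖ω y‖) →
      (b ^ 3)⁻¹ * |m| ≤ (b ^ 2)⁻¹ * (6 * ‖ω y‖) := fun b hb h =>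
    calc (b ^ 3)⁻¹ * |m| ≤ (b ^ 3)⁻¹ * (b * (6 * ‖ω y‖)) := by gcongr
      _ = (b ^ 3)⁻¹ * b * (6 * ‖ω y‖) := by ring
      _ ≤ _ := by gcongr; exact inv_cube_mul_self_le b hb
  calc |quotientKernel ω t y| = |t|⁻¹ * (|(a ^ 3)⁻¹ - (c ^ 3)⁻¹| * |m|) := by
        rw [quotientKernel, abs_mul, abs_mul, abs_inv, mul_assoc]
    _ ≤ |t|⁻¹ * (((a ^ 3)⁻¹ + (c ^ 3)⁻¹) * |m|) := by
        gcongr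
        refine (abs_sub _ _).trans_eq ?_
        rw [abs_of_nonneg (by positivity), abs_of_nonneg (by positivity)]
    _ ≤ |t|⁻¹ * (((a ^ 2)⁻¹ + (c ^ 2)⁻¹) * (6 * ‖ω y‖)) := by
        rw [add_mul, add_mul]
        exact mul_le_mul_of_nonneg_left (add_le_add (hone a ha0 hma) (hone c hc0 hmc))
          (by positivity)
    _ ≤ |t|⁻¹ * ((truncatedPower (-2) (6 * |t|) ((fun _ => t) - y) +
          truncatedPower (-2) (6 * |t|) y) * (6 * (C * (4 * |t|) ^ α))) := by
        gcongr
        exact add_nonneg (truncatedPower_nonneg _ _ _) (truncatedPower_nonneg _ _ _)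
    _ = _ := by ring

lemma abs_inv_cube_sub_inv_cube_le {a c d : ℝ} (hc : 0 < c) (hac : |a - c| ≤ d)
    (hd : 2 * d ≤ c) : |(a ^ 3)⁻¹ - (c ^ 3)⁻¹| ≤ 14 * d * (c ^ 4)⁻¹ := by
  have ha : c / 2 ≤ a := by linarith [(abs_le.1 hac).1]
  have ha0 : 0 < a := by linarith
  have hid : (a ^ 3)⁻¹ - (c ^ 3)⁻¹ =
      (c - a) * (a⁻¹ * (c ^ 3)⁻¹ + a⁻¹ ^ 2 * (c ^ 2)⁻¹ + a⁻¹ ^ 3 * c⁻¹) := by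
    field_simp; ring
  have hinv : a⁻¹ ≤ 2 * c⁻¹ := by
    rw [inv_le_comm₀ ha0 (by positivity), mul_inv, inv_inv]; linarith
  have hd0 : 0 ≤ d := (abs_nonneg _).trans hac
  rw [hid, abs_mul, abs_sub_comm, abs_of_nonneg (a := _ + _) (by positivity)]
  calc |a - c| * (a⁻¹ * (c ^ 3)⁻¹ + a⁻¹ ^ 2 * (c ^ 2)⁻¹ + a⁻¹ ^ 3 * c⁻¹)
      ≤ d * (2 * c⁻¹ * (c ^ 3)⁻¹ + (2 * c⁻¹) ^ 2 * (c ^ 2)⁻¹ + (2 * c⁻¹) ^ 3 * c⁻¹) := by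
        gcongr
    _ = _ := by field_simp; norm_num; ring

lemma abs_quotientKernel_le_of_far {t : ℝ} {y : V3} (ht : t ≠ 0) (hy : 4 * |t| ≤ enorm3 y) :
    |quotientKernel ω t y| ≤ 168 * ((enorm3 y ^ 3)⁻¹ * ‖ω y‖) := by
  have ht' : 0 < |t| := abs_pos.2 ht
  have hc : 0 < enorm3 y := by linarith
  have hac : |enorm3 ((fun _ => t) - y) - enorm3 y| ≤ 2 * |t| := by
    refine (abs_enorm3_sub_enorm3_le _ _).trans ?_
    rw [sub_add_cancel]; exact enorm3_diagonal_le t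
  have h := abs_inv_cube_sub_inv_cube_le hc hac (by linarith)
  rw [quotientKernel, abs_mul, abs_mul, abs_inv]
  calc |t|⁻¹ * _ * _ ≤ |t|⁻¹ * (14 * (2 * |t|) * (enorm3 y ^ 4)⁻¹) * (6 * enorm3 y * ‖ω y‖) := by
        gcongr; exact abs_axialMoment_le _ _
    _ = _ := by field_simp; norm_num; ring

lemma integrable_inv_cube_mul_norm (hωi : Integrable ω) (hα : 0 < α) (hα1 : α < 1) (hC : 0 ≤ C)
    (hω : ∀ y, ‖ω y‖ ≤ C * enorm3 y ^ α) :
    Integrable fun y => (enorm3 y ^ 3)⁻¹ * ‖ω y‖ := by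
  refine Integrable.mono' (((integrable_truncatedPower (p := α - 3) (by linarith) 1).const_mul
    C).add hωi.norm) ?_ (ae_of_all _ fun y => ?_)
  · exact ((continuous_enorm3.measurable.pow_const 3).inv.aestronglyMeasurable).mul
      hωi.aestronglyMeasurable.norm
  have hc := enorm3_nonneg y
  rw [Real.norm_of_nonneg (by positivity), Pi.add_apply]
  have hT := mul_nonneg hC (truncatedPower_nonneg (α - 3) 1 y)
  rcases eq_or_ne y 0 with rfl | h0
  · simpa [enorm3_zero] using add_nonneg hT (norm_nonneg _)
  have hn := norm_pos_iff.2 h0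
  have hcpos := enorm3_pos h0
  rcases lt_or_ge ‖y‖ 1 with h1 | h1
  · refine le_add_of_le_of_nonneg ?_ (norm_nonneg _)
    rw [truncatedPower_of_lt h1]
    calc (enorm3 y ^ 3)⁻¹ * ‖ω y‖ ≤ (enorm3 y ^ 3)⁻¹ * (C * enorm3 y ^ α) := by
          gcongr; exact hω y
      _ = C * enorm3 y ^ (α - 3) := by
          rw [Real.rpow_sub hcpos]; norm_num; ring
      _ ≤ C * ‖y‖ ^ (α - 3) := by
          gcongr C * ?_
          exact Real.rpow_le_rpow_of_nonpos hn (norm_le_enorm3 y) (by linarith)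
  · refine le_add_of_nonneg_of_le hT (mul_le_of_le_one_left (norm_nonneg _) ?_)
    exact inv_le_one_of_one_le₀ (one_le_pow₀ (h1.trans (norm_le_enorm3 y)))

lemma tendsto_setIntegral_quotientKernel_near (hα : 0 < α) (hC : 0 ≤ C)
    (hω : ∀ y, ‖ω y‖ ≤ C * enorm3 y ^ α) :
    Tendsto (fun t => ∫ y in {y | enorm3 y < 4 * |t|}, quotientKernel ω t y)
      (𝓝[≠] 0) (𝓝 0) := by
  obtain ⟨K, hK⟩ := integral_truncatedPower_neg_two
  have hlim : Tendsto (fun t : ℝ => 72 * C * K * (4 * |t|) ^ α) (𝓝[≠] 0) (𝓝 0) := by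
    have hcont : Continuous fun t : ℝ => 72 * C * K * (4 * |t|) ^ α := by
      have := hα.le
      fun_prop (disch := assumption)
    have := hcont.tendsto 0
    simp only [abs_zero, mul_zero, Real.zero_rpow hα.ne'] at this
    exact this.mono_left nhdsWithin_le_nhds
  refine squeeze_zero_norm' ?_ hlim
  filter_upwards [self_mem_nhdsWithin] with t ht
  have ht' : 0 < |t| := abs_pos.2 ht
  have hmeas : MeasurableSet {y : V3 | enorm3 y < 4 * |t|} :=
    measurableSet_lt continuous_enorm3.measurable measurable_const
  have hTi := integrable_truncatedPower (p := -2) (by norm_num) (6 * |t|)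
  have hbi := ((hTi.comp_sub_left fun _ => t).add hTi).const_mul
    (6 * (|t|⁻¹ * (C * (4 * |t|) ^ α)))
  rw [← integral_indicator hmeas]
  refine (norm_integral_le_of_norm_le hbi (ae_of_all _ fun y => ?_)).trans_eq ?_
  · by_cases hy : y ∈ {y : V3 | enorm3 y < 4 * |t|}
    · rw [Set.indicator_of_mem hy]
      exact abs_quotientKernel_le_of_near hα hC hω hy
    · rw [Set.indicator_of_notMem hy, norm_zero]
      exact mul_nonneg (by positivity)
        (add_nonneg (truncatedPower_nonneg _ _ _) (truncatedPower_nonneg _ _ _))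
  · rw [integral_const_mul]
    simp only [Pi.add_apply]
    rw [integral_add (hTi.comp_sub_left _) hTi,
      integral_sub_left_eq_self (truncatedPower (-2) (6 * |t|)), hK _ (by positivity)]
    field_simp
    norm_num
    ring

lemma tendsto_setIntegral_quotientKernel_far (hωi : Integrable ω) (hα : 0 < α) (hα1 : α < 1)
    (hC : 0 ≤ C) (hω : ∀ y, ‖ω y‖ ≤ C * enorm3 y ^ α)
    (hint : ∀ t, Integrable (quotientKernel ω t)) :
    Tendsto (fun t => ∫ y in {y | enorm3 y < 4 * |t|}ᶜ, quotientKernel ω t y) (𝓝[≠] 0)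
      (𝓝 (∫ y, 3 * (y 0 + y 1 + y 2) / enorm3 y ^ 5 * axialMoment y (ω y))) := by
  have hmeas : ∀ t : ℝ, MeasurableSet {y : V3 | enorm3 y < 4 * |t|}ᶜ := fun t =>
    (measurableSet_lt continuous_enorm3.measurable measurable_const).compl
  simp only [← integral_indicator (hmeas _)]
  refine tendsto_integral_filter_of_dominated_convergence
    (fun y => 168 * ((enorm3 y ^ 3)⁻¹ * ‖ω y‖))
    (Eventually.of_forall fun t => ((hint t).indicator (hmeas t)).aestronglyMeasurable) ?_
    ((integrable_inv_cube_mul_norm hωi hα hα1 hC hω).const_mul _) ?_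
  · filter_upwards [self_mem_nhdsWithin] with t ht
    refine ae_of_all _ fun y => ?_
    by_cases hy : y ∈ {y : V3 | enorm3 y < 4 * |t|}ᶜ
    · rw [Set.indicator_of_mem hy]
      exact abs_quotientKernel_le_of_far ht (not_lt.1 hy)
    · rw [Set.indicator_of_notMem hy, norm_zero]
      have := enorm3_nonneg y
      positivity
  · filter_upwards [Measure.ae_ne volume (0 : V3)] with y hy
    have hd := (hasDerivAt_iff_tendsto_slope_zero.1 (hasDerivAt_inv_enorm3_cube hy)).mul_const
      (axialMoment y (ω y))
    refine hd.congr' ?_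
    have hev : ∀ᶠ t : ℝ in 𝓝[≠] 0, 4 * |t| < enorm3 y := by
      have hcont : Continuous fun t : ℝ => 4 * |t| := by fun_prop
      have := hcont.tendsto 0
      simp only [abs_zero, mul_zero] at this
      exact (this.mono_left nhdsWithin_le_nhds).eventually_lt_const (enorm3_pos hy)
    filter_upwards [hev] with t ht
    rw [Set.indicator_of_mem (show y ∈ {y : V3 | enorm3 y < 4 * |t|}ᶜ from not_lt.2 ht.le)]
    have h0 : enorm3 ((fun _ => (0 : ℝ)) - y) = enorm3 y := by simp [enorm3]
    simp only [quotientKernel, smul_eq_mul, zero_add, h0]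

lemma tendsto_integral_quotientKernel (hωi : Integrable ω) (hα : 0 < α) (hα1 : α < 1)
    (hC : 0 ≤ C) (hω : ∀ y, ‖ω y‖ ≤ C * enorm3 y ^ α)
    (hint : ∀ t, Integrable (quotientKernel ω t)) :
    Tendsto (fun t => ∫ y, quotientKernel ω t y) (𝓝[≠] 0)
      (𝓝 (∫ y, 3 * (y 0 + y 1 + y 2) / enorm3 y ^ 5 * axialMoment y (ω y))) := by
  have h := (tendsto_setIntegral_quotientKernel_near hα hC hω).add
    (tendsto_setIntegral_quotientKernel_far hωi hα hα1 hC hω hint)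
  rw [zero_add] at h
  refine h.congr fun t => integral_add_compl ?_ (hint t)
  exact measurableSet_lt continuous_enorm3.measurable measurable_const

end Quotient

section Assembly

variable {u ω : V3 → V3} {α C : ℝ}

lemma enorm3_comp_rotate (x : V3) : enorm3 (fun k => x (finRotate 3 k)) = enorm3 x := by
  unfold enorm3
  rw [Equiv.sum_comp (finRotate 3) fun i => x i ^ 2]

lemma PermSymmetric.gradient_zero (hu : PermSymmetric u) (hd : Differentiable ℝ u)
    (hdiv : ∑ i, pd i (fun y => u y i) 0 = 0) :
    (∀ i, pd i (fun y => u y i) 0 = 0) ∧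
      ∃ b, ∀ i j, i ≠ j → pd i (fun y => u y j) 0 = b := by
  have hr := fun i j => hu.equivariantUnder_finRotate.pd_apply hd i j 0
  have hs := hu.equivariantUnder_swap.pd_apply hd 0 1 0
  have h0 : (fun k => (0 : V3) (finRotate 3 k)) = 0 := rfl
  have h0' : (fun k => (0 : V3) (Equiv.swap 0 1 k)) = 0 := rfl
  simp only [h0, finRotate_apply] at hr
  simp only [h0', Equiv.swap_apply_left, Equiv.swap_apply_right] at hs
  have h00 := hr 0 0
  have h11 := hr 1 1
  have h01 := hr 0 1
  have h12 := hr 1 2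
  have h10 := hr 1 0
  have h21 := hr 2 1
  simp only [Fin.isValue, Fin.reduceAdd, zero_add] at h00 h11 h01 h12 h10 h21
  rw [Fin.sum_univ_three] at hdiv
  refine ⟨fun i => ?_, pd 0 (fun y => u y 1) 0, fun i j hij => ?_⟩
  · fin_cases i <;> simp only [Fin.zero_eta, Fin.mk_one, Fin.reduceFinMk] <;> linarith
  · fin_cases i <;> fin_cases j <;>
      simp only [Fin.zero_eta, Fin.mk_one, Fin.reduceFinMk, ne_eq, not_true_eq_false] at hij ⊢ <;>
      linarith

lemma integrable_lambda_integrand (hω : AEStronglyMeasurable ω)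
    (hG : Integrable fun y => (enorm3 y ^ 3)⁻¹ * ‖ω y‖) (i j k : Fin 3) :
    Integrable fun x : V3 => ((x 0 + x 1 + x 2) * (x i - x j) / enorm3 x ^ 5) * ω x k := by
  refine Integrable.mono' (hG.const_mul 6) ?_ (ae_of_all _ fun y => ?_)
  · have hN := continuous_enorm3.measurable
    have hk : AEStronglyMeasurable fun x => ω x k :=
      (continuous_apply k).comp_aestronglyMeasurable hω
    refine AEStronglyMeasurable.mul (Measurable.aestronglyMeasurable ?_) hk
    fun_prop
  · have hc := enorm3_nonneg y
    have h := abs_apply_le_enorm3 y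
    have hS : |y 0 + y 1 + y 2| ≤ 3 * enorm3 y :=
      (abs_add_three _ _ _).trans (by linarith [h 0, h 1, h 2])
    have hD : |y i - y j| ≤ 2 * enorm3 y := (abs_sub _ _).trans (by linarith [h i, h j])
    rw [Real.norm_eq_abs, abs_mul, abs_div, abs_mul, abs_of_nonneg (pow_nonneg hc 5)]
    calc |y 0 + y 1 + y 2| * |y i - y j| / enorm3 y ^ 5 * |ω y k|
        ≤ 3 * enorm3 y * (2 * enorm3 y) / enorm3 y ^ 5 * ‖ω y‖ := by
          gcongr
          exact norm_le_pi_norm (ω y) k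
      _ = 6 * ((enorm3 y ^ 3)⁻¹ * ‖ω y‖) := by
          rcases hc.eq_or_lt with h0 | h0
          · simp [← h0]
          · field_simp; norm_num; ring

lemma hasDerivAt_sum_diagonal (hωi : Integrable ω) (hα : 0 < α) (hα1 : α < 1)
    (hC : 0 ≤ C) (hω : ∀ y, ‖ω y‖ ≤ C * enorm3 y ^ α) (hbs : BiotSavartRep u ω) :
    HasDerivAt (fun t : ℝ => ∑ j, u (fun _ => t) j)
      (-(4 * π)⁻¹ * ∫ y, 3 * (y 0 + y 1 + y 2) / enorm3 y ^ 5 * axialMoment y (ω y)) 0 := by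
  have hint : ∀ t : ℝ, Integrable fun y =>
      (enorm3 ((fun _ => t) - y) ^ 3)⁻¹ * axialMoment y (ω y) := fun t => by
    simp only [← sum_bsKernel_diagonal]
    exact integrable_finsetSum _ fun j _ => (hbs fun _ => t).1.eval j
  have hrep : ∀ t : ℝ, ∑ j, u (fun _ => t) j = -(4 * π)⁻¹ *
      ∫ y, (enorm3 ((fun _ => t) - y) ^ 3)⁻¹ * axialMoment y (ω y) := fun t => by
    simp only [← sum_bsKernel_diagonal]
    rw [integral_finsetSum _ fun j _ => (hbs fun _ => t).1.eval j, Finset.mul_sum]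
    refine Finset.sum_congr rfl fun j _ => ?_
    rw [(hbs fun _ => t).2, Pi.smul_apply, eval_integral fun i => (hbs fun _ => t).1.eval i,
      smul_eq_mul]
  have hq : ∀ t, quotientKernel ω t = fun y =>
      t⁻¹ * ((enorm3 ((fun _ => t) - y) ^ 3)⁻¹ * axialMoment y (ω y) -
        (enorm3 ((fun _ => (0 : ℝ)) - y) ^ 3)⁻¹ * axialMoment y (ω y)) := fun t => by
    ext y
    have h0 : enorm3 ((fun _ => (0 : ℝ)) - y) = enorm3 y := by simp [enorm3]
    rw [quotientKernel, h0]
    ring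
  have hlim := (tendsto_integral_quotientKernel hωi hα hα1 hC hω fun t => by
    rw [hq]; exact ((hint t).sub (hint 0)).const_mul _).const_mul (-(4 * π)⁻¹)
  rw [hasDerivAt_iff_tendsto_slope_zero]
  refine hlim.congr fun t => ?_
  rw [zero_add, hrep, hrep, hq, integral_const_mul, integral_sub (hint t) (hint 0), smul_eq_mul]
  ring

lemma hasDerivAt_sum_diagonal_of_differentiable (hu : Differentiable ℝ u) :
    HasDerivAt (fun t : ℝ => ∑ j, u (fun _ => t) j)
      (∑ j, ∑ i, pd i (fun y => u y j) 0) 0 := by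
  refine HasDerivAt.fun_sum fun j _ => ?_
  have hd : Differentiable ℝ fun y => u y j := by fun_prop
  have hline : HasDerivAt (fun t : ℝ => (fun _ => t : V3)) (fun _ => 1) 0 :=
    hasDerivAt_pi.2 fun _ => hasDerivAt_id 0
  refine ((hd 0).hasFDerivAt.comp_hasDerivAt (0 : ℝ) hline).congr_deriv ?_
  simp only [pd]
  rw [← map_sum]
  congr 1
  ext k
  simp [Pi.single_apply]

end Assembly

/-- For a `C¹`, permutation symmetric, divergence free vector field `u` with curl `ω`
integrable, bounded, and `α`-Hölder continuous, having the Biot-Savart representation: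
the gradient at the origin satisfies `∂ᵢuᵢ(0) = 0` and `∂ᵢu_j(0) = −λ` for `i ≠ j`, where
`λ = (3/(8π)) ∫ ((x₁+x₂+x₃)(x₂−x₃)/|x|⁵) ω₁(x) dx` converges absolutely, and `λ` equals
the analogous integrals against `ω₂` and `ω₃`. -/
theorem gradient_at_origin
    (u ω : V3 → V3) (hu : ContDiff ℝ 1 u) (hperm : PermSymmetric u)
    (hdiv : ∀ x, ∑ i, pd i (fun y => u y i) x = 0)
    (hcurl : ∀ x, curl u x = ω x)
    (hωi : Integrable ω) (hωb : ∃ C, ∀ x, enorm3 (ω x) ≤ C)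
    (α : ℝ) (hα : 0 < α) (hα1 : α < 1)
    (hHolder : ∃ C, ∀ x y, enorm3 (ω x - ω y) ≤ C * enorm3 (x - y) ^ α)
    (hbs : BiotSavartRep u ω) :
    Integrable (fun x : V3 =>
        ((x 0 + x 1 + x 2) * (x 1 - x 2) / enorm3 x ^ 5) * ω x 0) ∧
    (∀ i, pd i (fun y => u y i) 0 = 0) ∧
    (∀ i j, i ≠ j → pd i (fun y => u y j) 0 =
      -((3 / (8 * π)) *
        ∫ x : V3, ((x 0 + x 1 + x 2) * (x 1 - x 2) / enorm3 x ^ 5) * ω x 0)) ∧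
    ((3 / (8 * π)) * ∫ x : V3, ((x 0 + x 1 + x 2) * (x 1 - x 2) / enorm3 x ^ 5) * ω x 0)
      = ((3 / (8 * π)) *
        ∫ x : V3, ((x 0 + x 1 + x 2) * (x 2 - x 0) / enorm3 x ^ 5) * ω x 1) ∧
    ((3 / (8 * π)) * ∫ x : V3, ((x 0 + x 1 + x 2) * (x 1 - x 2) / enorm3 x ^ 5) * ω x 0)
      = ((3 / (8 * π)) *
        ∫ x : V3, ((x 0 + x 1 + x 2) * (x 0 - x 1) / enorm3 x ^ 5) * ω x 2) := by
  have hud : Differentiable ℝ u := hu.differentiable one_ne_zero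
  have hωeq : curl u = ω := funext hcurl
  have hrot := hperm.equivariantUnder_finRotate
  have hωrot : EquivariantUnder (finRotate 3) ω := hωeq ▸ hrot.curl_apply hud
  obtain ⟨hdiag, b, hoff⟩ := hperm.gradient_zero hud (hdiv 0)
  have hω0 : ω 0 = 0 := by
    rw [← hcurl 0]
    ext i
    fin_cases i <;> simp [curl, hoff]
  obtain ⟨C₀, hC₀⟩ := hHolder
  have hω : ∀ y, ‖ω y‖ ≤ |C₀| * enorm3 y ^ α := fun y => by
    have h := hC₀ y 0
    rw [hω0, sub_zero, sub_zero] at h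
    refine (norm_le_enorm3 _).trans (h.trans ?_)
    exact mul_le_mul_of_nonneg_right (le_abs_self _) (Real.rpow_nonneg (enorm3_nonneg y) _)
  have hG := integrable_inv_cube_mul_norm hωi hα hα1 (abs_nonneg C₀) hω
  have hI := fun i j k => integrable_lambda_integrand hωi.aestronglyMeasurable hG i j k
  set I : ℝ := ∫ x : V3, ((x 0 + x 1 + x 2) * (x 1 - x 2) / enorm3 x ^ 5) * ω x 0 with hIdef
  have hI1 : I = ∫ x : V3, ((x 0 + x 1 + x 2) * (x 2 - x 0) / enorm3 x ^ 5) * ω x 1 := by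
    rw [hIdef, ← integral_comp_rotate]
    refine integral_congr_ae (ae_of_all _ fun x => ?_)
    have h := hωrot x 0
    have hN := enorm3_comp_rotate x
    simp only [finRotate_apply, zero_add, Fin.isValue, Fin.reduceAdd] at h hN ⊢
    rw [h, hN]
    ring
  have hI2 : I = ∫ x : V3, ((x 0 + x 1 + x 2) * (x 0 - x 1) / enorm3 x ^ 5) * ω x 2 := by
    rw [hI1, ← integral_comp_rotate]
    refine integral_congr_ae (ae_of_all _ fun x => ?_)
    have h := hωrot x 1
    have hN := enorm3_comp_rotate x
    simp only [finRotate_apply, zero_add, Fin.isValue, Fin.reduceAdd] at h hN ⊢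
    rw [h, hN]
    ring
  have hb : b = -(3 / (8 * π) * I) := by
    have hmoment : ∫ y, 3 * (y 0 + y 1 + y 2) / enorm3 y ^ 5 * axialMoment y (ω y) = 9 * I := by
      have h3 : (9 : ℝ) * I = 3 * (I + I + I) := by ring
      rw [h3]
      nth_rewrite 2 [hI1]
      nth_rewrite 2 [hI2]
      have h12 := integral_add (hI 1 2 0) (hI 2 0 1)
      have h123 := integral_add ((hI 1 2 0).add (hI 2 0 1)) (hI 0 1 2)
      simp only [Pi.add_apply] at h123
      rw [hIdef, ← h12, ← h123, ← integral_const_mul]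
      refine integral_congr_ae (ae_of_all _ fun y => ?_)
      simp only [axialMoment]
      ring
    have hslope := hasDerivAt_sum_diagonal hωi hα hα1 (abs_nonneg C₀) hω hbs
    have hsum := hasDerivAt_sum_diagonal_of_differentiable hud
    have h := hslope.unique hsum
    rw [hmoment] at h
    simp only [Fin.sum_univ_three, hdiag, hoff 0 1 (by decide), hoff 0 2 (by decide),
      hoff 1 0 (by decide), hoff 1 2 (by decide), hoff 2 0 (by decide),
      hoff 2 1 (by decide)] at h
    have hpi := Real.pi_pos.ne'
    field_simp at h ⊢
    linarith
  refine ⟨hI 1 2 0, hdiag, fun i j hij => (hoff i j hij).trans hb, ?_, ?_⟩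
  · rw [hI1]
  · rw [← hI2]

end
end
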